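/- Let vol(B₃) = 3·(∫₀^{2π/3} −ln(2 sin θ) dθ + 2·∫₀^{π/6} −ln(2 sin θ) dθ) and vol(B₄) = 4·(∫₀^{π/2} −ln(2 sin θ) dθ + 2·∫₀^{π/4} −ln(2 sin θ) dθ). Then exp((2·vol(B₃) + vol(B₄))/(2π)) ≤ 3.418677233748620053022. -/

import Mathlib

open Real

theorem arctan_alt {x : ℝ} (h0 : 0 ≤ x) (h1 : x < 1) (k : ℕ) :
    ∑ i ∈ Finset.range (2 * k), (-1 : ℝ) ^ i * (x ^ (2 * i + 1) / ((2 * i + 1 : ℕ) : ℝ)) ≤ arctan x ∧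
    arctan x ≤ ∑ i ∈ Finset.range (2 * k + 1), (-1 : ℝ) ^ i * (x ^ (2 * i + 1) / ((2 * i + 1 : ℕ) : ℝ)) := by
  have hs := (Real.hasSum_arctan (x := x) (by rwa [Real.norm_of_nonneg h0])).tendsto_sum_nat
  simp only [mul_div_assoc] at hs
  have hanti : Antitone (fun i : ℕ => x ^ (2 * i + 1) / ((2 * i + 1 : ℕ) : ℝ)) := by
    intro a b hab
    have h2 : x ^ (2 * b + 1) ≤ x ^ (2 * a + 1) := pow_le_pow_of_le_one h0 h1.le (by omega)
    have h3 : ((2 * a + 1 : ℕ) : ℝ) ≤ ((2 * b + 1 : ℕ) : ℝ) := by exact_mod_cast (by omega)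
    exact div_le_div₀ (by positivity) h2 (by positivity) h3
  exact ⟨hanti.alternating_series_le_tendsto hs k, hanti.tendsto_le_alternating_series hs k⟩

theorem pi_lo : (3.141592653589793238462643383279 : ℝ) ≤ π := by
  have h := Real.four_mul_arctan_inv_5_sub_arctan_inv_239
  have h1 := (arctan_alt (x := 5⁻¹) (by norm_num) (by norm_num) 12).1
  have h2 := (arctan_alt (x := 239⁻¹) (by norm_num) (by norm_num) 4).2
  norm_num [Finset.sum_range_succ] at h1 h2
  norm_num at h
  linarith

theorem pi_hi : π ≤ (3.141592653589793238462643383280 : ℝ) := by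
  have h := Real.four_mul_arctan_inv_5_sub_arctan_inv_239
  have h1 := (arctan_alt (x := 5⁻¹) (by norm_num) (by norm_num) 11).2
  have h2 := (arctan_alt (x := 239⁻¹) (by norm_num) (by norm_num) 4).1
  norm_num [Finset.sum_range_succ] at h1 h2
  norm_num at h
  linarith


theorem bern_odd (k : ℕ) : bernoulli' (2*k+3) = 0 :=
  bernoulli'_eq_zero_of_odd ⟨k+1, by ring⟩ (by omega)
theorem bern2 : bernoulli' 2 = 1/6 := bernoulli'_two
theorem bern4 : bernoulli' 4 = -1/30 := bernoulli'_four

theorem bern6 : bernoulli' 6 = 1/42 := by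
  rw [bernoulli'_def]
  norm_num [Finset.sum_range_succ, Nat.choose, bern2, bern4, bern_odd 0, bern_odd 1]

theorem bern8 : bernoulli' 8 = -1/30 := by
  rw [bernoulli'_def]
  norm_num [Finset.sum_range_succ, Nat.choose, bern2, bern4, bern6, bern_odd 0, bern_odd 1, bern_odd 2]

theorem bern10 : bernoulli' 10 = 5/66 := by
  rw [bernoulli'_def]
  norm_num [Finset.sum_range_succ, Nat.choose, bern2, bern4, bern6, bern8, bern_odd 0, bern_odd 1, bern_odd 2, bern_odd 3]

theorem bern12 : bernoulli' 12 = -691/2730 := by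
  rw [bernoulli'_def]
  norm_num [Finset.sum_range_succ, Nat.choose, bern2, bern4, bern6, bern8, bern10, bern_odd 0, bern_odd 1, bern_odd 2, bern_odd 3, bern_odd 4]

theorem bern14 : bernoulli' 14 = 7/6 := by
  rw [bernoulli'_def]
  norm_num [Finset.sum_range_succ, Nat.choose, bern2, bern4, bern6, bern8, bern10, bern12, bern_odd 0, bern_odd 1, bern_odd 2, bern_odd 3, bern_odd 4, bern_odd 5]

theorem bern16 : bernoulli' 16 = -3617/510 := by
  rw [bernoulli'_def]
  norm_num [Finset.sum_range_succ, Nat.choose, bern2, bern4, bern6, bern8, bern10, bern12, bern14, bern_odd 0, bern_odd 1, bern_odd 2, bern_odd 3, bern_odd 4, bern_odd 5, bern_odd 6]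

theorem bern18 : bernoulli' 18 = 43867/798 := by
  rw [bernoulli'_def]
  norm_num [Finset.sum_range_succ, Nat.choose, bern2, bern4, bern6, bern8, bern10, bern12, bern14, bern16, bern_odd 0, bern_odd 1, bern_odd 2, bern_odd 3, bern_odd 4, bern_odd 5, bern_odd 6, bern_odd 7]

theorem bern20 : bernoulli' 20 = -174611/330 := by
  rw [bernoulli'_def]
  norm_num [Finset.sum_range_succ, Nat.choose, bern2, bern4, bern6, bern8, bern10, bern12, bern14, bern16, bern18, bern_odd 0, bern_odd 1, bern_odd 2, bern_odd 3, bern_odd 4, bern_odd 5, bern_odd 6, bern_odd 7, bern_odd 8]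


theorem zeta_part {n : ℕ} (hn : n ≠ 0) (m : ℕ) :
    ∑ k ∈ Finset.range m, 1 / ((k : ℝ) + 1) ^ (2 * n) ≤
      (-1) ^ (n + 1) * 2 ^ (2 * n - 1) * π ^ (2 * n) * (bernoulli' (2 * n) : ℝ) / (2 * n).factorial := by
  have h := hasSum_zeta_nat hn
  rw [bernoulli_eq_bernoulli'_of_ne_one (by omega)] at h
  have h2 := sum_le_hasSum (Finset.range (m + 1)) (fun i _ => by positivity) h
  rw [Finset.sum_range_succ'] at h2
  simpa [hn] using h2

noncomputable def zb : ℕ → ℝ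

  | 1 => 1.644934066848226436472415167
  | 2 => 1.082323233711138191516003697
  | 3 => 1.017343061984449139714517930
  | 4 => 1.004077356197944339378685239
  | 5 => 1.000994575127818085337145959
  | 6 => 1.000246086553308048298637999
  | 7 => 1.000061248135058704829258546
  | 8 => 1.000015282259408651871732572
  | 9 => 1.000003817293264999839856462
  | 10 => 1.000000953962033872796113153
  | n => 1 + 1 / 4 ^ n + 0.0000000002877174665461131521 / 9 ^ (n - 10)

theorem zeta_b1 (m : ℕ) : ∑ k ∈ Finset.range m, 1 / ((k : ℝ) + 1) ^ 2 ≤ 1.644934066848226436472415167 := by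
  have h := zeta_part (n := 1) (by norm_num) m
  have hp : π ^ 2 ≤ 3.141592653589793238462643383280 ^ 2 := pow_le_pow_left₀ pi_pos.le pi_hi _
  norm_num [bern2, Nat.factorial] at h hp ⊢
  linarith

theorem zeta_b2 (m : ℕ) : ∑ k ∈ Finset.range m, 1 / ((k : ℝ) + 1) ^ 4 ≤ 1.082323233711138191516003697 := by
  have h := zeta_part (n := 2) (by norm_num) m
  have hp : π ^ 4 ≤ 3.141592653589793238462643383280 ^ 4 := pow_le_pow_left₀ pi_pos.le pi_hi _
  norm_num [bern4, Nat.factorial] at h hp ⊢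
  linarith

theorem zeta_b3 (m : ℕ) : ∑ k ∈ Finset.range m, 1 / ((k : ℝ) + 1) ^ 6 ≤ 1.017343061984449139714517930 := by
  have h := zeta_part (n := 3) (by norm_num) m
  have hp : π ^ 6 ≤ 3.141592653589793238462643383280 ^ 6 := pow_le_pow_left₀ pi_pos.le pi_hi _
  norm_num [bern6, Nat.factorial] at h hp ⊢
  linarith

theorem zeta_b4 (m : ℕ) : ∑ k ∈ Finset.range m, 1 / ((k : ℝ) + 1) ^ 8 ≤ 1.004077356197944339378685239 := by
  have h := zeta_part (n := 4) (by norm_num) m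
  have hp : π ^ 8 ≤ 3.141592653589793238462643383280 ^ 8 := pow_le_pow_left₀ pi_pos.le pi_hi _
  norm_num [bern8, Nat.factorial] at h hp ⊢
  linarith

theorem zeta_b5 (m : ℕ) : ∑ k ∈ Finset.range m, 1 / ((k : ℝ) + 1) ^ 10 ≤ 1.000994575127818085337145959 := by
  have h := zeta_part (n := 5) (by norm_num) m
  have hp : π ^ 10 ≤ 3.141592653589793238462643383280 ^ 10 := pow_le_pow_left₀ pi_pos.le pi_hi _
  norm_num [bern10, Nat.factorial] at h hp ⊢
  linarith

theorem zeta_b6 (m : ℕ) : ∑ k ∈ Finset.range m, 1 / ((k : ℝ) + 1) ^ 12 ≤ 1.000246086553308048298637999 := by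
  have h := zeta_part (n := 6) (by norm_num) m
  have hp : π ^ 12 ≤ 3.141592653589793238462643383280 ^ 12 := pow_le_pow_left₀ pi_pos.le pi_hi _
  norm_num [bern12, Nat.factorial] at h hp ⊢
  linarith

theorem zeta_b7 (m : ℕ) : ∑ k ∈ Finset.range m, 1 / ((k : ℝ) + 1) ^ 14 ≤ 1.000061248135058704829258546 := by
  have h := zeta_part (n := 7) (by norm_num) m
  have hp : π ^ 14 ≤ 3.141592653589793238462643383280 ^ 14 := pow_le_pow_left₀ pi_pos.le pi_hi _
  norm_num [bern14, Nat.factorial] at h hp ⊢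
  linarith

theorem zeta_b8 (m : ℕ) : ∑ k ∈ Finset.range m, 1 / ((k : ℝ) + 1) ^ 16 ≤ 1.000015282259408651871732572 := by
  have h := zeta_part (n := 8) (by norm_num) m
  have hp : π ^ 16 ≤ 3.141592653589793238462643383280 ^ 16 := pow_le_pow_left₀ pi_pos.le pi_hi _
  norm_num [bern16, Nat.factorial] at h hp ⊢
  linarith

theorem zeta_b9 (m : ℕ) : ∑ k ∈ Finset.range m, 1 / ((k : ℝ) + 1) ^ 18 ≤ 1.000003817293264999839856462 := by
  have h := zeta_part (n := 9) (by norm_num) m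
  have hp : π ^ 18 ≤ 3.141592653589793238462643383280 ^ 18 := pow_le_pow_left₀ pi_pos.le pi_hi _
  norm_num [bern18, Nat.factorial] at h hp ⊢
  linarith

theorem zeta_b10 (m : ℕ) : ∑ k ∈ Finset.range m, 1 / ((k : ℝ) + 1) ^ 20 ≤ 1.000000953962033872796113152100000000000000000 := by
  have h := zeta_part (n := 10) (by norm_num) m
  have hp : π ^ 20 ≤ 3.141592653589793238462643383280 ^ 20 := pow_le_pow_left₀ pi_pos.le pi_hi _
  norm_num [bern20, Nat.factorial] at h hp ⊢
  linarith


theorem zeta_big (n : ℕ) (hn : 10 ≤ n) (m : ℕ) :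
    ∑ k ∈ Finset.range m, 1 / ((k : ℝ) + 1) ^ (2 * n) ≤ 1 + 1 / 4 ^ n + 0.0000000002877174665461131521 / 9 ^ (n - 10) := by
  have hmono : ∑ k ∈ Finset.range m, 1 / ((k : ℝ) + 1) ^ (2 * n) ≤
      ∑ k ∈ Finset.range (m + 2), 1 / ((k : ℝ) + 1) ^ (2 * n) := by
    apply Finset.sum_le_sum_of_subset_of_nonneg
    · intro a ha
      simp only [Finset.mem_range] at ha ⊢
      omega
    · intros
      positivity
  have h10 := zeta_b10 (m + 2)
  rw [Finset.sum_range_succ', Finset.sum_range_succ'] at h10 hmono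
  have ht : ∑ k ∈ Finset.range m, 1 / (((k + 1 + 1 : ℕ) : ℝ) + 1) ^ (2 * n) ≤
      (∑ k ∈ Finset.range m, 1 / (((k + 1 + 1 : ℕ) : ℝ) + 1) ^ 20) / 9 ^ (n - 10) := by
    rw [Finset.sum_div]
    apply Finset.sum_le_sum
    intro k _
    obtain ⟨d, rfl⟩ := Nat.exists_eq_add_of_le hn
    rw [div_div]
    apply one_div_le_one_div_of_le (by positivity)
    have e1 : (((k + 1 + 1 : ℕ) : ℝ) + 1) ^ (2 * (10 + d)) =
      (((k + 1 + 1 : ℕ) : ℝ) + 1) ^ 20 * ((((k + 1 + 1 : ℕ) : ℝ) + 1) ^ 2) ^ d := by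
      rw [← pow_mul, ← pow_add]
      congr 1
      ring
    rw [e1, Nat.add_sub_cancel_left]
    apply mul_le_mul_of_nonneg_left _ (by positivity)
    apply pow_le_pow_left₀ (by norm_num)
    push_cast
    nlinarith [(Nat.cast_nonneg k : (0 : ℝ) ≤ k)]
  have e2 : (2 : ℝ) ^ (2 * n) = 4 ^ n := by
    rw [pow_mul]
    norm_num
  have h11 : ∑ k ∈ Finset.range m, 1 / (((k + 1 + 1 : ℕ) : ℝ) + 1) ^ 20 ≤ 0.0000000002877174665461131521 := by
    norm_num at h10 ⊢
    linarith
  have h12 := div_le_div_of_nonneg_right h11 (show (0 : ℝ) ≤ 9 ^ (n - 10) by positivity)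
  have e3 : ((0 + 1 : ℕ) : ℝ) + 1 = 2 := by norm_num
  have e4 : ((0 : ℕ) : ℝ) + 1 = 1 := by norm_num
  rw [e3, e4, one_pow, e2] at hmono
  linarith

theorem zeta_zb (n : ℕ) (hn : n ≠ 0) (m : ℕ) :
    ∑ k ∈ Finset.range m, 1 / ((k : ℝ) + 1) ^ (2 * n) ≤ zb n := by
  by_cases h : n ≤ 9
  · interval_cases n
    · exact absurd rfl hn
    · exact zeta_b1 m
    · exact zeta_b2 m
    · exact zeta_b3 m
    · exact zeta_b4 m
    · exact zeta_b5 m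
    · exact zeta_b6 m
    · exact zeta_b7 m
    · exact zeta_b8 m
    · exact zeta_b9 m
  · by_cases h' : n = 10
    · subst h'
      refine (zeta_b10 m).trans ?_
      norm_num [zb]
    · have e : zb n = 1 + 1 / 4 ^ n + 0.0000000002877174665461131521 / 9 ^ (n - 10) := by
        rw [zb] <;> omega
      rw [e]
      exact zeta_big n (by omega) m

noncomputable def remP (x : ℝ) : ℝ :=
  (∑ i ∈ Finset.range 19, zb (i + 1) / ((i : ℝ) + 1) * x ^ (2 * (i + 1))) + zb 20 * (16 / 15) * x ^ 40

theorem neg_log_prod_le {x : ℝ} (hx0 : 0 < x) (hx : x ≤ 1 / 4) (m : ℕ) :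
    -remP x ≤ ∑ j ∈ Finset.range m, Real.log (1 - x ^ 2 / ((j : ℝ) + 1) ^ 2) := by
  have hx2 : x ^ 2 ≤ 1 / 16 := by nlinarith
  have key : ∀ j : ℕ, -Real.log (1 - x ^ 2 / ((j : ℝ) + 1) ^ 2) ≤
      (∑ i ∈ Finset.range 19, x ^ (2 * (i + 1)) / ((i : ℝ) + 1) * (1 / ((j : ℝ) + 1) ^ (2 * (i + 1)))) +
        (16 / 15) * x ^ 40 * (1 / ((j : ℝ) + 1) ^ 40) := by
    intro j
    set u := x ^ 2 / ((j : ℝ) + 1) ^ 2 with hu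
    have hj : (1 : ℝ) ≤ ((j : ℝ) + 1) ^ 2 := by
      nlinarith [(Nat.cast_nonneg j : (0 : ℝ) ≤ j)]
    have hu0 : 0 ≤ u := by positivity
    have hu1 : u ≤ 1 / 16 := (div_le_self (by positivity) hj).trans hx2
    have h := Real.abs_log_sub_add_sum_range_le (x := u) (by rw [abs_of_nonneg hu0]; linarith) 19
    rw [abs_of_nonneg hu0] at h
    have h1 := (abs_le.mp h).1
    have h2 : u ^ (19 + 1) / (1 - u) ≤ (16 / 15) * u ^ (19 + 1) := by
      rw [div_le_iff₀ (by linarith)]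
      nlinarith [pow_nonneg hu0 20]
    have h3 : ∑ i ∈ Finset.range 19, u ^ (i + 1) / ((i : ℝ) + 1) =
        ∑ i ∈ Finset.range 19, x ^ (2 * (i + 1)) / ((i : ℝ) + 1) * (1 / ((j : ℝ) + 1) ^ (2 * (i + 1))) := by
      apply Finset.sum_congr rfl
      intro i _
      rw [hu, div_pow, ← pow_mul, ← pow_mul]
      ring
    have h4 : u ^ (19 + 1) = x ^ 40 * (1 / ((j : ℝ) + 1) ^ 40) := by
      rw [hu, div_pow, ← pow_mul, ← pow_mul]
      ring
    rw [h3] at h1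
    rw [h4] at h1 h2
    linarith
  have hs := Finset.sum_le_sum (fun j (_ : j ∈ Finset.range m) => key j)
  rw [Finset.sum_neg_distrib, Finset.sum_add_distrib, Finset.sum_comm, ← Finset.mul_sum] at hs
  have ha : ∑ i ∈ Finset.range 19, ∑ j ∈ Finset.range m,
      x ^ (2 * (i + 1)) / ((i : ℝ) + 1) * (1 / ((j : ℝ) + 1) ^ (2 * (i + 1))) ≤
      ∑ i ∈ Finset.range 19, zb (i + 1) / ((i : ℝ) + 1) * x ^ (2 * (i + 1)) := by
    apply Finset.sum_le_sum
    intro i _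
    rw [← Finset.mul_sum]
    have h := mul_le_mul_of_nonneg_left (zeta_zb (i + 1) (by omega) m)
      (show 0 ≤ x ^ (2 * (i + 1)) / ((i : ℝ) + 1) by positivity)
    refine h.trans (le_of_eq ?_)
    ring
  have hb := mul_le_mul_of_nonneg_left (zeta_zb 20 (by omega) m)
      (show 0 ≤ (16 / 15) * x ^ 40 by positivity)
  unfold remP
  norm_num at hb hs ha ⊢
  linarith

theorem logsin_bound {x : ℝ} (hx0 : 0 < x) (hx : x ≤ 1 / 4) :
    -Real.log (2 * Real.sin (π * x)) ≤ -Real.log (2 * π) - Real.log x + remP x := by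
  have hlim := Real.tendsto_euler_sin_prod x
  have hge : π * x * Real.exp (-remP x) ≤ Real.sin (π * x) := by
    apply ge_of_tendsto' hlim
    intro m
    apply mul_le_mul_of_nonneg_left _ (by positivity)
    have hpos : ∀ j ∈ Finset.range m, 0 < 1 - x ^ 2 / ((j : ℝ) + 1) ^ 2 := by
      intro j _
      have hj : (1 : ℝ) ≤ ((j : ℝ) + 1) ^ 2 := by
        nlinarith [(Nat.cast_nonneg j : (0 : ℝ) ≤ j)]
      have := div_le_self (sq_nonneg x) hj
      nlinarith
    rw [← Real.le_log_iff_exp_le (Finset.prod_pos hpos), Real.log_prod (fun j hj => (hpos j hj).ne')]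
    exact neg_log_prod_le hx0 hx m
  have h1 : 2 * π * (x * Real.exp (-remP x)) ≤ 2 * Real.sin (π * x) := by linarith
  have h2 := Real.log_le_log (by positivity) h1
  rw [Real.log_mul (x := 2 * π) (by positivity) (by positivity),
    Real.log_mul (x := x) (by positivity) (by positivity), Real.log_exp] at h2
  linarith

theorem ii_f (a b : ℝ) : IntervalIntegrable (fun θ => -Real.log (2 * Real.sin θ)) MeasureTheory.volume a b := by
  have h : AnalyticOnNhd ℝ (fun θ => 2 * Real.sin θ) Set.univ := by
    intro x _
    fun_prop
  exact (MeromorphicOn.intervalIntegrable_log (fun x _ => (h x (Set.mem_univ x)).meromorphicAt)).neg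

theorem remP_cont : Continuous remP := by
  unfold remP
  fun_prop

noncomputable def intP (x : ℝ) : ℝ :=
  (∑ i ∈ Finset.range 19, zb (i + 1) / ((i : ℝ) + 1) * (x ^ (2 * i + 3) / (2 * (i : ℝ) + 3))) +
    zb 20 * (16 / 15) * (x ^ 41 / 41)

theorem integral_remP (a : ℝ) : ∫ x in (0 : ℝ)..a, remP x = intP a := by
  unfold remP intP
  rw [intervalIntegral.integral_add, intervalIntegral.integral_finsetSum]
  · simp only [intervalIntegral.integral_const_mul, integral_pow]
    congr 1
    · apply Finset.sum_congr rfl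
      intro i _
      have e : 2 * (i + 1) + 1 = 2 * i + 3 := by ring
      rw [e]
      push_cast
      simp
      left
      ring
    · norm_num
  · intro i _
    apply Continuous.intervalIntegrable
    fun_prop
  · apply Continuous.intervalIntegrable
    fun_prop
  · apply Continuous.intervalIntegrable
    fun_prop

theorem lob_bound {a : ℝ} (ha0 : 0 < a) (ha : a ≤ 1 / 4) :
    ∫ θ in (0 : ℝ)..(π * a), -Real.log (2 * Real.sin θ) ≤
      π * (a - a * Real.log (2 * π * a) + intP a) := by
  have h1 := intervalIntegral.integral_comp_mul_left (a := 0) (b := a)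
    (fun θ => -Real.log (2 * Real.sin θ)) pi_ne_zero
  rw [mul_zero, smul_eq_mul] at h1
  have h2 : ∫ θ in (0 : ℝ)..(π * a), -Real.log (2 * Real.sin θ) =
      π * ∫ x in (0 : ℝ)..a, -Real.log (2 * Real.sin (π * x)) := by
    rw [h1, mul_inv_cancel_left₀ pi_ne_zero]
  rw [h2]
  apply mul_le_mul_of_nonneg_left _ pi_pos.le
  have hi : IntervalIntegrable (fun x : ℝ => -Real.log (2 * π) - Real.log x) MeasureTheory.volume 0 a :=
    intervalIntegrable_const.sub intervalIntegral.intervalIntegrable_log'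
  have h3 : ∫ x in (0 : ℝ)..a, -Real.log (2 * Real.sin (π * x)) ≤
      ∫ x in (0 : ℝ)..a, ((-Real.log (2 * π) - Real.log x) + remP x) := by
    apply intervalIntegral.integral_mono_on_of_le_Ioo ha0.le
    · have h : AnalyticOnNhd ℝ (fun θ => 2 * Real.sin (π * θ)) Set.univ := by
        intro x _
        fun_prop
      exact (MeromorphicOn.intervalIntegrable_log (fun x _ => (h x (Set.mem_univ x)).meromorphicAt)).neg
    · exact hi.add (remP_cont.intervalIntegrable _ _)
    · intro x hx
      exact logsin_bound hx.1 (hx.2.le.trans ha)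
  refine h3.trans (le_of_eq ?_)
  rw [intervalIntegral.integral_add hi (remP_cont.intervalIntegrable _ _), integral_remP,
    intervalIntegral.integral_sub intervalIntegrable_const intervalIntegral.intervalIntegrable_log',
    integral_log, intervalIntegral.integral_const, smul_eq_mul,
    Real.log_mul (by positivity) ha0.ne']
  simp
  ring

theorem int_half : ∫ θ in (0 : ℝ)..(π / 2), -Real.log (2 * Real.sin θ) = 0 := by
  have h : ∫ θ in (0 : ℝ)..(π / 2), -Real.log (2 * Real.sin θ) =
      ∫ θ in (0 : ℝ)..(π / 2), (-Real.log 2 - Real.log (Real.sin θ)) := by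
    apply intervalIntegral.integral_congr_Ioo_of_le (by positivity)
    intro x hx
    have := Real.sin_pos_of_pos_of_lt_pi hx.1 (by linarith [hx.2, pi_pos])
    simp only
    rw [Real.log_mul (by norm_num) this.ne']
    ring
  have hi : IntervalIntegrable (fun θ => Real.log (Real.sin θ)) MeasureTheory.volume 0 (π / 2) :=
    intervalIntegrable_log_sin
  rw [h, intervalIntegral.integral_sub intervalIntegrable_const hi,
    integral_log_sin_zero_pi_div_two]
  simp
  ring

theorem int_third : ∫ θ in (0 : ℝ)..(2 * π / 3), -Real.log (2 * Real.sin θ) =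
    -(2 / 3) * ∫ θ in (0 : ℝ)..(π / 6), -Real.log (2 * Real.sin θ) := by
  set f : ℝ → ℝ := fun θ => -Real.log (2 * Real.sin θ) with hf
  have hA := intervalIntegral.integral_add_adjacent_intervals (ii_f 0 (π / 3)) (ii_f (π / 3) (π / 2))
  have hB := intervalIntegral.integral_add_adjacent_intervals (ii_f 0 (π / 2)) (ii_f (π / 2) (2 * π / 3))
  rw [int_half] at hA hB
  have hC := intervalIntegral.integral_comp_sub_left (a := π / 3) (b := π / 2) f π
  have hD := intervalIntegral.integral_comp_sub_left (a := 0) (b := π / 6) f (π / 2)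
  have hE := intervalIntegral.integral_comp_mul_left (a := 0) (b := π / 6) f (two_ne_zero)
  simp only [hf, Real.sin_pi_sub] at hC
  have e1 : π - π / 2 = π / 2 := by ring
  have e2 : π - π / 3 = 2 * π / 3 := by ring
  have e3 : π / 2 - π / 6 = π / 3 := by ring
  have e4 : 2 * (π / 6) = π / 3 := by ring
  rw [e1, e2] at hC
  rw [e3, sub_zero] at hD
  rw [e4, mul_zero, smul_eq_mul] at hE
  have hF : ∫ x in (0 : ℝ)..(π / 6), f (2 * x) = ∫ x in (0 : ℝ)..(π / 6), (f x + f (π / 2 - x)) := by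
    apply intervalIntegral.integral_congr_Ioo_of_le (by positivity)
    intro x hx
    have h1 := Real.sin_pos_of_pos_of_lt_pi hx.1 (by linarith [hx.2, pi_pos])
    have h2 : 0 < Real.cos x := Real.cos_pos_of_mem_Ioo ⟨by linarith [hx.1, pi_pos], by linarith [hx.2, pi_pos]⟩
    simp only [hf, Real.sin_two_mul, Real.sin_pi_div_two_sub]
    have e : 2 * (2 * Real.sin x * Real.cos x) = (2 * Real.sin x) * (2 * Real.cos x) := by ring
    rw [e, Real.log_mul (by positivity) (by positivity)]
    ring
  have hi : IntervalIntegrable (fun x => f (π / 2 - x)) MeasureTheory.volume 0 (π / 6) := by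
    have h : AnalyticOnNhd ℝ (fun θ => 2 * Real.sin (π / 2 - θ)) Set.univ := by
      intro x _
      fun_prop
    exact (MeromorphicOn.intervalIntegrable_log (fun x _ => (h x (Set.mem_univ x)).meromorphicAt)).neg
  rw [intervalIntegral.integral_add (ii_f _ _) hi, hD, hE] at hF
  simp only [hf] at hF ⊢
  linarith

theorem num_Q : 5 + 12 * intP (1 / 6) + 12 * intP (1 / 4) ≤ 5.13474441773256132506707579 := by
  norm_num [intP, zb, Finset.sum_range_succ]

theorem num_exp : Real.exp 5.13474441773256132506707579 ≤ 2.35323443293461493975726241 ^ 6 := by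
  have e : (5.13474441773256132506707579 : ℝ) = ((6 : ℕ) : ℝ) * (5.13474441773256132506707579 / 6) := by norm_num
  rw [e, Real.exp_nat_mul]
  apply pow_le_pow_left₀ (Real.exp_pos _).le
  have h := Real.exp_bound' (x := 5.13474441773256132506707579 / 6) (by norm_num) (by norm_num) (n := 26) (by norm_num)
  refine h.trans ?_
  norm_num [Finset.sum_range_succ, Nat.factorial]

theorem exp_vol_bound :
    Real.exp ((2 * ((3 : ℝ) * ((∫ θ in (0:ℝ)..(2 * π / 3), -Real.log (2 * Real.sin θ)) +
        2 * ∫ θ in (0:ℝ)..(π / 6), -Real.log (2 * Real.sin θ))) +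
      (4 : ℝ) * ((∫ θ in (0:ℝ)..(π / 2), -Real.log (2 * Real.sin θ)) +
        2 * ∫ θ in (0:ℝ)..(π / 4), -Real.log (2 * Real.sin θ))) / (2 * π)) ≤
    3.418677233748620053022 := by
  rw [int_third, int_half]
  have h6 := lob_bound (a := 1 / 6) (by norm_num) (by norm_num)
  have h4 := lob_bound (a := 1 / 4) (by norm_num) (by norm_num)
  have e6 : π * (1 / 6) = π / 6 := by ring
  have e4 : π * (1 / 4) = π / 4 := by ring
  rw [e6] at h6
  rw [e4] at h4
  set A := ∫ θ in (0:ℝ)..(π / 6), -Real.log (2 * Real.sin θ)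
  set B := ∫ θ in (0:ℝ)..(π / 4), -Real.log (2 * Real.sin θ)
  have hE : (2 * ((3 : ℝ) * (-(2 / 3) * A + 2 * A)) + 4 * (0 + 2 * B)) / (2 * π) = 4 * (A + B) / π := by
    field_simp
    ring
  rw [hE]
  have e6' : 2 * π * (1 / 6) = π / 3 := by ring
  have e4' : 2 * π * (1 / 4) = π / 2 := by ring
  rw [e6'] at h6
  rw [e4'] at h4
  have hb : 4 * (A + B) / π ≤ 4 * (1 / 6 - 1 / 6 * Real.log (π / 3) + intP (1 / 6)
      + (1 / 4 - 1 / 4 * Real.log (π / 2) + intP (1 / 4))) := by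
    rw [div_le_iff₀ pi_pos]
    linarith
  have hlog : Real.log (π ^ 5 / 72) = 2 * Real.log (π / 3) + 3 * Real.log (π / 2) := by
    have e : π ^ 5 / 72 = (π / 3) ^ 2 * (π / 2) ^ 3 := by ring
    rw [e, Real.log_mul (by positivity) (by positivity), Real.log_pow, Real.log_pow]
    norm_num
  have h3 : 3 * (4 * (A + B) / π) ≤ 5.13474441773256132506707579 - Real.log (π ^ 5 / 72) := by
    rw [hlog]
    linarith [num_Q]
  have h5 : Real.exp (4 * (A + B) / π) ^ 3 ≤ 3.418677233748620053022 ^ 3 := by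
    rw [← Real.exp_nat_mul]
    refine (Real.exp_le_exp.mpr (show ((3 : ℕ) : ℝ) * (4 * (A + B) / π) ≤ _ by exact_mod_cast h3)).trans ?_
    rw [Real.exp_sub, Real.exp_log (by positivity), div_le_iff₀ (by positivity)]
    refine num_exp.trans ?_
    have hp : 3.141592653589793238462643383279 ^ 5 ≤ π ^ 5 := pow_le_pow_left₀ (by norm_num) pi_lo _
    norm_num at hp ⊢
    linarith
  exact le_of_pow_le_pow_left₀ (by norm_num) (by norm_num) h5
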